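/- arXiv:1301.3608 — 5 statements merged into one kernel-verified Lean document; each statement's English description precedes it below -/
import Mathlib

section
/- (Simon's Lemma) For all integers d, s ≥ 0, the polynomial S_{d,s} ∈ F[t₁,…,t_s] is nonzero if and only if d(q−1) ≤ s. -/
/-- The monic polynomial of degree `d` over `F` with lower-order coefficients
given by `c : Fin d → F`: `X^d + ∑_{i<d} c i * X^i`.
As `c` ranges over `Fin d → F`, this enumerates the set `A⁺(d)` of monic
polynomials of degree `d` in `A = F[θ]`. -/
noncomputable def monicOf (F : Type*) [Field F] (d : ℕ) (c : Fin d → F) : Polynomial F :=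
  Polynomial.X ^ d + ∑ i : Fin d, Polynomial.C (c i) * Polynomial.X ^ (i : ℕ)

/-- `S_{d,s} = ∑_{a ∈ A⁺(d)} a(t₁) ⋯ a(t_s) ∈ F[t₁,…,t_s]`, where `a(t_i)` is the
image of `a` under the `F`-algebra map `F[θ] → F[t₁,…,t_s]` sending `θ` to `t_i`. -/
noncomputable def Sds (F : Type*) [Field F] [Fintype F] (d s : ℕ) :
    MvPolynomial (Fin s) F :=
  ∑ c : Fin d → F, ∏ i : Fin s, Polynomial.aeval (MvPolynomial.X i) (monicOf F d c)

/-- The sum of the `(q - 1)`-st powers of the elements of a field with `q` elements is `-1`. -/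
theorem sum_pow_card_sub_one (F : Type*) [Field F] [Fintype F] :
    ∑ x : F, x ^ (Fintype.card F - 1) = -1 := by
  classical
  have h1 : 1 < Fintype.card F := Fintype.one_lt_card
  have h : ∀ x : F, x ^ (Fintype.card F - 1) = 1 - if x = 0 then 1 else 0 := by
    intro x
    split_ifs with hx
    · rw [hx, zero_pow (by omega), sub_self]
    · rw [FiniteField.pow_card_sub_one_eq_one x hx, sub_zero]
  simp [h]

theorem aeval_X_monicOf (F : Type*) [Field F] (d : ℕ) {σ : Type*} (c : Fin d → F) (i : σ) :
    Polynomial.aeval (MvPolynomial.X i : MvPolynomial σ F) (monicOf F d c) =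
      ∑ k : Fin (d + 1), MvPolynomial.C (Fin.snoc (α := fun _ => F) c 1 k) *
        MvPolynomial.X i ^ (k : ℕ) := by
  rw [Fin.sum_univ_castSucc]
  simp [monicOf, add_comm, MvPolynomial.algebraMap_eq]

theorem sum_prod_snoc_one (F : Type*) [Field F] [Fintype F] {d : ℕ} {ι : Type*} [Fintype ι]
    (p : ι → Fin (d + 1)) :
    ∑ c : Fin d → F, ∏ i, Fin.snoc (α := fun _ => F) c 1 (p i) =
      ∏ j : Fin d, ∑ x : F, x ^ (Finset.univ.filter fun i => p i = j.castSucc).card := by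
  classical
  rw [Finset.prod_univ_sum, Fintype.piFinset_univ]
  refine Finset.sum_congr rfl fun c _ => ?_
  rw [← Finset.prod_fiberwise' Finset.univ p (Fin.snoc (α := fun _ => F) c 1),
    Fin.prod_univ_castSucc]
  simp

/-- Expansion of `S_{d,s}` into monomials, with power sums over `F` as coefficients. -/
theorem Sds_eq_sum_monomial (F : Type*) [Field F] [Fintype F] (d s : ℕ) :
    Sds F d s = ∑ p : Fin s → Fin (d + 1),
      MvPolynomial.monomial (Finsupp.equivFunOnFinite.symm fun i => (p i : ℕ))
        (∏ j : Fin d, ∑ x : F, x ^ (Finset.univ.filter fun i => p i = j.castSucc).card) := by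
  classical
  simp_rw [← sum_prod_snoc_one, map_sum]
  rw [Finset.sum_comm, Sds]
  refine Finset.sum_congr rfl fun c _ => ?_
  simp_rw [aeval_X_monicOf]
  rw [Finset.prod_univ_sum, Fintype.piFinset_univ]
  refine Finset.sum_congr rfl fun p _ => ?_
  rw [Finset.prod_mul_distrib, MvPolynomial.monomial_eq, map_prod,
    Finsupp.prod_fintype _ _ (by simp)]
  simp

theorem coeff_Sds (F : Type*) [Field F] [Fintype F] (d s : ℕ) (p : Fin s → Fin (d + 1)) :
    (Sds F d s).coeff (Finsupp.equivFunOnFinite.symm fun i => (p i : ℕ)) =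
      ∏ j : Fin d, ∑ x : F, x ^ (Finset.univ.filter fun i => p i = j.castSucc).card := by
  classical
  rw [Sds_eq_sum_monomial, MvPolynomial.coeff_sum, Finset.sum_eq_single p]
  · simp
  · intro p' _ hp
    rw [MvPolynomial.coeff_monomial, if_neg]
    contrapose! hp
    have := Finsupp.equivFunOnFinite.symm.injective hp
    funext i
    exact Fin.ext (congrFun this i)
  · simp

theorem card_filter_min_div {d s m : ℕ} (hm : 0 < m) (h : d * m ≤ s) (j : Fin d) :
    (Finset.univ.filter fun i : Fin s =>
      (⟨min (i / m) d, by omega⟩ : Fin (d + 1)) = j.castSucc).card = m := by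
  have hj := j.2
  have hle : (j + 1) * m ≤ s := (Nat.mul_le_mul_right m hj).trans h
  have : (Finset.univ.filter fun i : Fin s =>
      (⟨min (i / m) d, by omega⟩ : Fin (d + 1)) = j.castSucc).map Fin.valEmbedding =
      Finset.Ico (j * m) ((j + 1) * m) := by
    ext i
    have key : min (i / m) d = j ↔ j * m ≤ i ∧ i < (j + 1) * m := by
      rw [← Nat.le_div_iff_mul_le hm, ← Nat.div_lt_iff_lt_mul hm]
      omega
    simp only [Finset.mem_map, Finset.mem_filter, Finset.mem_univ, true_and, Fin.ext_iff,
      Fin.val_castSucc, Fin.valEmbedding_apply, Finset.mem_Ico]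
    rw [← key]
    constructor
    · rintro ⟨a, ha, rfl⟩
      exact ha
    · intro hi
      exact ⟨⟨i, (key.1 hi).2.trans_le hle⟩, hi, rfl⟩
  rw [← Finset.card_map, this, Nat.card_Ico, ← Nat.sub_mul, Nat.add_sub_cancel_left, one_mul]

/-- Simon's Lemma: `S_{d,s} ≠ 0` iff `d(q-1) ≤ s`. -/
theorem simons_lemma (F : Type*) [Field F] [Fintype F] (q : ℕ) (hq : Fintype.card F = q)
    (d s : ℕ) : Sds F d s ≠ 0 ↔ d * (q - 1) ≤ s := by
  classical
  subst hq
  constructor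
  · intro h
    rw [Sds_eq_sum_monomial] at h
    obtain ⟨p, -, hp⟩ := Finset.exists_ne_zero_of_sum_ne_zero h
    rw [Ne, MvPolynomial.monomial_eq_zero, Finset.prod_eq_zero_iff] at hp
    push Not at hp
    have hcard (j : Fin d) : Fintype.card F - 1 ≤
        (Finset.univ.filter fun i => p i = j.castSucc).card := by
      by_contra! hlt
      exact hp j (Finset.mem_univ j) (FiniteField.sum_pow_lt_card_sub_one F _ hlt)
    calc d * (Fintype.card F - 1) = ∑ _j : Fin d, (Fintype.card F - 1) := by simp
      _ ≤ ∑ j : Fin d, (Finset.univ.filter fun i => p i = j.castSucc).card :=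
        Finset.sum_le_sum fun j _ => hcard j
      _ ≤ ∑ k : Fin (d + 1), (Finset.univ.filter fun i => p i = k).card := by
        rw [Fin.sum_univ_castSucc]
        exact Nat.le_add_right _ _
      _ = s := by
        rw [← Finset.card_eq_sum_card_fiberwise (fun _ _ => Finset.mem_coe.2 (Finset.mem_univ _))]
        simp
  · intro h h0
    have hm : 0 < Fintype.card F - 1 := Nat.sub_pos_of_lt Fintype.one_lt_card
    have hc := coeff_Sds F d s fun i => ⟨min (i / (Fintype.card F - 1)) d, by omega⟩
    simp_rw [card_filter_min_div hm h, sum_pow_card_sub_one, h0, MvPolynomial.coeff_zero] at hc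
    rw [Finset.prod_const] at hc
    exact pow_ne_zero _ (neg_ne_zero.2 one_ne_zero) hc.symm
end

section
/- Let s ≥ 1 be an integer and let N ≥ 0 be any integer with (N+1)(q−1) > s, so that F_s := ∑_{d=0}^{N} S_{d,s} ∈ F[t₁,…,t_s] (this sum does not depend on the choice of such N, since S_{d,s} = 0 whenever d(q−1) > s). Then F_s = 0 if and only if s ≡ 0 (mod q−1). -/
open MvPolynomial in
/-- The sum of `a(t₁) ⋯ a(t_s)` over all polynomials `a` of degree less than `n`. -/
noncomputable def sumDegreeLT (F : Type*) [Field F] [Fintype F] (n s : ℕ) :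
    MvPolynomial (Fin s) F :=
  ∑ c : Fin n → F, ∏ i : Fin s, ∑ k : Fin n, C (c k) * X i ^ (k : ℕ)

open MvPolynomial in
lemma aeval_monicOf (F : Type*) [Field F] {σ : Type*} (d : ℕ) (c : Fin d → F) (i : σ) :
    Polynomial.aeval (X i : MvPolynomial σ F) (monicOf F d c) =
      X i ^ d + ∑ k : Fin d, C (c k) * X i ^ (k : ℕ) := by
  simp [monicOf, algebraMap_eq]

open MvPolynomial in
/-- By the Chevalley–Warning argument, `sumDegreeLT` vanishes when `s < n (q - 1)`. -/
lemma sumDegreeLT_eq_zero (F : Type*) [Field F] [Fintype F] (n s : ℕ)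
    (h : s < n * (Fintype.card F - 1)) : sumDegreeLT F n s = 0 := by
  classical
  have key (p : Fin s → Fin n) : ∑ c : Fin n → F, ∏ i, c (p i) = 0 := by
    have hdeg : (∏ i, X (p i) : MvPolynomial (Fin n) F).totalDegree
        < (Fintype.card F - 1) * Fintype.card (Fin n) := by
      calc _ ≤ ∑ i, (X (p i) : MvPolynomial (Fin n) F).totalDegree :=
            totalDegree_finsetProd _ _
        _ = s := by simp
        _ < _ := by rwa [Fintype.card_fin, mul_comm]
    simpa [map_prod] using sum_eval_eq_zero _ hdeg
  simp only [sumDegreeLT, Fintype.prod_sum, Finset.prod_mul_distrib]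
  rw [Finset.sum_comm]
  refine Finset.sum_eq_zero fun p _ ↦ ?_
  rw [← Finset.sum_mul]
  simp only [← map_prod, ← map_sum]
  rw [key, map_zero, zero_mul]

open MvPolynomial in
lemma sumDegreeLT_succ (F : Type*) [Field F] [Fintype F] (n s : ℕ)
    (h : Fintype.card F - 1 ∣ s) :
    sumDegreeLT F (n + 1) s = sumDegreeLT F n s - Sds F n s := by
  classical
  have hpow (x : F) (hx : x ≠ 0) : x ^ s = 1 := by
    obtain ⟨m, rfl⟩ := h
    rw [pow_mul, FiniteField.pow_card_sub_one_eq_one x hx, one_pow]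
  have hsplit : sumDegreeLT F (n + 1) s = ∑ x : F, ∑ c : Fin n → F,
      ∏ i : Fin s, (C x * X i ^ n + ∑ k : Fin n, C (c k) * X i ^ (k : ℕ)) := by
    rw [sumDegreeLT, ← (Fin.snocEquiv fun _ ↦ F).sum_comp, Fintype.sum_prod_type]
    simp [Fin.sum_univ_castSucc, add_comm]
  have hne (x : F) (hx : x ≠ 0) : ∑ c : Fin n → F,
      ∏ i : Fin s, (C x * X i ^ n + ∑ k : Fin n, C (c k) * X i ^ (k : ℕ)) = Sds F n s := by
    rw [Sds, ← (Equiv.piCongrRight fun _ : Fin n ↦ Equiv.mulLeft₀ x hx).sum_comp]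
    refine Finset.sum_congr rfl fun c _ ↦ ?_
    have (i : Fin s) : C x * X i ^ n + ∑ k : Fin n, C (x * c k) * X i ^ (k : ℕ) =
        C x * (X i ^ n + ∑ k : Fin n, C (c k) * X i ^ (k : ℕ)) := by
      simp [mul_add, Finset.mul_sum, mul_assoc]
    simp only [Equiv.piCongrRight_apply, Pi.map_apply, Equiv.mulLeft₀_apply, this,
      Finset.prod_mul_distrib, aeval_monicOf]
    simp [← map_pow, hpow x hx]
  rw [hsplit, ← Finset.add_sum_erase _ _ (Finset.mem_univ 0),
    Finset.sum_congr rfl fun x hx ↦ hne x (Finset.ne_of_mem_erase hx)]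
  have hcard : ((Fintype.card F - 1 : ℕ) : MvPolynomial (Fin s) F) = -1 := by
    rw [Nat.cast_pred Fintype.card_pos, ← map_natCast C, FiniteField.cast_card_eq_zero]
    simp
  simp [sumDegreeLT, hcard, sub_eq_add_neg]

lemma sumDegreeLT_eq_neg_sum_Sds (F : Type*) [Field F] [Fintype F] (n s : ℕ) (hs : s ≠ 0)
    (h : Fintype.card F - 1 ∣ s) :
    sumDegreeLT F n s = -∑ d ∈ Finset.range n, Sds F d s := by
  induction n with
  | zero => simp [sumDegreeLT, hs]
  | succ n ih =>
    rw [sumDegreeLT_succ F n s h, ih, Finset.sum_range_succ]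
    ring

lemma constantCoeff_Sds_zero (F : Type*) [Field F] [Fintype F] (s : ℕ) :
    MvPolynomial.constantCoeff (Sds F 0 s) = 1 := by
  simp [Sds, monicOf]

lemma constantCoeff_Sds_succ (F : Type*) [Field F] [Fintype F] (d s : ℕ)
    (h : ¬ Fintype.card F - 1 ∣ s) :
    MvPolynomial.constantCoeff (Sds F (d + 1) s) = 0 := by
  have hsum : MvPolynomial.constantCoeff (Sds F (d + 1) s) =
      ∑ c : Fin (d + 1) → F, c 0 ^ s := by
    simp [Sds, aeval_monicOf, Fin.sum_univ_succ]
  rw [← FiniteField.forall_pow_eq_one_iff F s] at h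
  push Not at h
  obtain ⟨u, hu⟩ := h
  have hu' : (u : F) ^ s - 1 ≠ 0 := by
    rwa [sub_ne_zero, ← Units.val_pow_eq_pow_val, Ne, Units.val_eq_one]
  have hscale : ∑ c : Fin (d + 1) → F, c 0 ^ s =
      (u : F) ^ s * ∑ c : Fin (d + 1) → F, c 0 ^ s := by
    conv_lhs =>
      rw [← (Equiv.piCongrRight fun _ : Fin (d + 1) ↦ Equiv.mulLeft₀ (u : F) u.ne_zero).sum_comp]
    simp [mul_pow, Finset.mul_sum]
  rw [hsum]
  refine (mul_eq_zero.mp ?_).resolve_left hu'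
  rw [sub_mul, one_mul, ← hscale, sub_self]

/-- For `s ≥ 1` and any `N` with `(N+1)(q-1) > s`, the polynomial
`F_s = ∑_{d=0}^{N} S_{d,s}` vanishes iff `s ≡ 0 (mod q-1)`. -/
theorem Fs_eq_zero_iff (F : Type*) [Field F] [Fintype F] (q : ℕ) (hq : Fintype.card F = q)
    (s N : ℕ) (hs : 1 ≤ s) (hN : s < (N + 1) * (q - 1)) :
    (∑ d ∈ Finset.range (N + 1), Sds F d s) = 0 ↔ (q - 1) ∣ s := by
  subst hq
  constructor
  · intro h
    by_contra hdvd
    have h0 := congrArg MvPolynomial.constantCoeff h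
    rw [map_sum, Finset.sum_range_succ', constantCoeff_Sds_zero,
      Finset.sum_eq_zero fun d _ ↦ constantCoeff_Sds_succ F d s hdvd] at h0
    simp at h0
  · intro hdvd
    rw [← neg_eq_zero, ← sumDegreeLT_eq_neg_sum_Sds F _ s (by omega) hdvd]
    exact sumDegreeLT_eq_zero F _ s hN
end

section
/- For every integer d ≥ 0 and every integer α ≥ 1, the element S_d(−α) := ∑_{a ∈ A⁺(d)} a^{−α} of K is nonzero. -/
open Polynomial IsDedekindDomain

section

variable {F : Type*} [Field F]

theorem monic_monicOf (d : ℕ) (c : Fin d → F) : (monicOf F d c).Monic :=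
  monic_X_pow_add (degree_sum_fin_lt c)

theorem degree_monicOf (d : ℕ) (c : Fin d → F) : (monicOf F d c).degree = d := by
  rw [monicOf, degree_add_eq_left_of_degree_lt, degree_X_pow]
  simpa using degree_sum_fin_lt c

theorem monicOf_coeff {p : F[X]} (hp : p.Monic) :
    monicOf F p.natDegree (fun i => p.coeff i) = p := by
  conv_rhs => rw [hp.as_sum]
  rw [monicOf, Finset.sum_range]

theorem coeff_monicOf (d : ℕ) (c : Fin d → F) (i : Fin d) : (monicOf F d c).coeff i = c i := by
  have hi : (i : ℕ) ≠ d := i.2.ne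
  simp [monicOf, coeff_X_pow, hi, finsetSum_coeff, Fin.val_inj]

theorem monicOf_injective (d : ℕ) : Function.Injective (monicOf F d) := fun a b h => by
  ext i
  rw [← coeff_monicOf d a, h, coeff_monicOf]

theorem exists_monic_irreducible_natDegree_eq_finrank (F E : Type*) [Field F] [Field E]
    [Algebra F E] [FiniteDimensional F E] [Algebra.IsSeparable F E] :
    ∃ p : F[X], p.Monic ∧ Irreducible p ∧ p.natDegree = Module.finrank F E := by
  obtain ⟨x, hx⟩ := Field.exists_primitive_element F E
  have hint : IsIntegral F x := IsIntegral.of_finite F x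
  exact ⟨minpoly F x, minpoly.monic hint, minpoly.irreducible hint,
    (Field.primitive_element_iff_minpoly_natDegree_eq F x).1 hx⟩

theorem exists_irreducible_monicOf [Finite F] {d : ℕ} (hd : d ≠ 0) :
    ∃ c : Fin d → F, Irreducible (monicOf F d c) := by
  obtain ⟨p, _⟩ := CharP.exists F
  have : NeZero d := ⟨hd⟩
  have : Fact p.Prime := ⟨CharP.char_is_prime F p⟩
  obtain ⟨P, hmonic, hirr, hdeg⟩ :=
    exists_monic_irreducible_natDegree_eq_finrank F (FiniteField.Extension F p d)
  obtain rfl : P.natDegree = d := hdeg.trans (FiniteField.finrank_extension F p d)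
  exact ⟨fun i => P.coeff i, by rwa [monicOf_coeff hmonic]⟩

theorem not_dvd_monicOf {d : ℕ} {c₀ c : Fin d → F} (h : c ≠ c₀) :
    ¬ monicOf F d c₀ ∣ monicOf F d c := fun hdvd =>
  h <| monicOf_injective d <| eq_of_monic_of_dvd_of_natDegree_le
    (monic_monicOf d c₀) (monic_monicOf d c) hdvd
    (natDegree_eq_of_degree_eq ((degree_monicOf d c).trans (degree_monicOf d c₀).symm)).le

end

/-- `S_d(−α) = ∑_{a ∈ A⁺(d)} a^{−α} ≠ 0` in `K = F(θ)`, for every `d ≥ 0` and `α ≥ 1`. -/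
theorem Sd_neg_alpha_ne_zero (F : Type*) [Field F] [Fintype F] (d α : ℕ) (hα : 1 ≤ α) :
    (∑ c : Fin d → F,
      (algebraMap (Polynomial F) (RatFunc F) (monicOf F d c))⁻¹ ^ α) ≠ 0 := by
  classical
  obtain rfl | hd := eq_or_ne d 0
  · simp [monicOf]
  obtain ⟨c₀, hirr⟩ := exists_irreducible_monicOf (F := F) hd
  set P := monicOf F d c₀
  let v : HeightOneSpectrum F[X] :=
    ⟨Ideal.span {P}, (Ideal.span_singleton_prime hirr.ne_zero).2 hirr.prime,
      by simpa using hirr.ne_zero⟩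
  have hle : v.valuation (RatFunc F) (∑ c ∈ Finset.univ.erase c₀,
      (algebraMap F[X] (RatFunc F) (monicOf F d c))⁻¹ ^ α) ≤ 1 := by
    refine Valuation.map_sum_le _ fun c hc => ?_
    have hone : v.valuation (RatFunc F) (algebraMap F[X] (RatFunc F) (monicOf F d c)) = 1 := by
      rw [HeightOneSpectrum.valuation_eq_one_iff_notMem, Ideal.mem_span_singleton]
      exact not_dvd_monicOf (Finset.ne_of_mem_erase hc)
    simp [hone]
  have hgt : 1 < v.valuation (RatFunc F) ((algebraMap F[X] (RatFunc F) P)⁻¹ ^ α) := by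
    have hlt : v.valuation (RatFunc F) (algebraMap F[X] (RatFunc F) P) < 1 := by
      rw [HeightOneSpectrum.valuation_lt_one_iff_mem]
      exact Ideal.mem_span_singleton_self P
    have hpos : 0 < v.valuation (RatFunc F) (algebraMap F[X] (RatFunc F) P) := by
      simpa [zero_lt_iff] using hirr.ne_zero
    rw [map_pow, map_inv₀]
    exact one_lt_pow₀ ((one_lt_inv₀ hpos).2 hlt) (by lia)
  rw [← Finset.add_sum_erase _ _ (Finset.mem_univ c₀)]
  intro h
  rw [eq_neg_of_add_eq_zero_left h, Valuation.map_neg] at hgt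
  exact hgt.not_ge hle
end

section
/- Let d, s, α be integers with d ≥ 0, s ≥ 1, α ≥ 1, and let l ≥ 0 be an integer such that q^l ≥ α and 2 ≤ ℓ_q(q^l − α) + s ≤ d(q−1). Then the product ∏_{j=1}^{s} (t_j − θ^{q^l}) divides S_{d,s}(−α) in K[t₁,…,t_s]. -/
/-- `S_{d,s}(−α) = ∑_{a ∈ A⁺(d)} a(t₁) ⋯ a(t_s) · a^{−α} ∈ K[t₁,…,t_s]`, where
`K = F(θ)` and `a(t_i)` is the image of `a` under the algebra map sending `θ` to `t_i`. -/
noncomputable def SdsK (F : Type*) [Field F] [Fintype F] (d s α : ℕ) :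
    MvPolynomial (Fin s) (RatFunc F) :=
  ∑ c : Fin d → F,
    MvPolynomial.C ((algebraMap (Polynomial F) (RatFunc F) (monicOf F d c))⁻¹ ^ α) *
      ∏ i : Fin s, Polynomial.aeval (MvPolynomial.X i) (monicOf F d c)

/-- `ℓ_q(n)`: the sum of the digits of `n` in base `q`. -/
def lq (q n : ℕ) : ℕ := (Nat.digits q n).sum

namespace MvPolynomial

/-- If `p` vanishes after each of the substitutions `X j ↦ a j`, then it is divisible by
`∏ j, (X j - C (a j))`. -/
theorem prod_X_sub_C_dvd {σ K : Type*} [Fintype σ] [DecidableEq σ] [Field K] (a : σ → K)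
    (p : MvPolynomial σ K)
    (h : ∀ j, aeval (Function.update X j (C (a j)) : σ → MvPolynomial σ K) p = 0) :
    (∏ j, (X j - C (a j))) ∣ p := by
  refine Fintype.prod_dvd_of_isRelPrime ?_ fun j => ?_
  · intro i j hij
    have hirr : Irreducible (X i - C (a i) : MvPolynomial σ K) := by
      have := irreducible_mul_X_add (1 : MvPolynomial σ K) (-C (a i)) i one_ne_zero (by simp)
        (by rw [vars_neg]; simp) isRelPrime_one_left
      rwa [one_mul, ← sub_eq_add_neg] at this
    refine hirr.isRelPrime_iff_not_dvd.2 fun hdvd => ?_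
    have := map_dvd (aeval (Function.update a j (a j + 1))) hdvd
    simp [Function.update_of_ne hij] at this
  · have hmk : (Ideal.Quotient.mkₐ K (Ideal.span {X j - C (a j)})).comp
        (aeval (Function.update X j (C (a j)) : σ → MvPolynomial σ K)) =
        Ideal.Quotient.mkₐ K (Ideal.span {X j - C (a j)}) := by
      ext i
      by_cases hi : i = j
      · subst hi
        simp only [AlgHom.comp_apply, aeval_X, Function.update_self, Ideal.Quotient.mkₐ_eq_mk]
        rw [eq_comm, Ideal.Quotient.eq]
        exact Ideal.mem_span_singleton_self _
      · simp [Function.update_of_ne hi]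
    have hp := DFunLike.congr_fun hmk p
    rw [AlgHom.comp_apply, h, map_zero, eq_comm, Ideal.Quotient.mkₐ_eq_mk,
      Ideal.Quotient.eq_zero_iff_mem, Ideal.mem_span_singleton] at hp
    exact hp

/-- A polynomial of small total degree over an algebra over a finite field `F` sums to zero
over the `F`-rational points. -/
theorem sum_eval_algebraMap_eq_zero {σ F R : Type*} [Fintype σ] [DecidableEq σ] [Field F]
    [Fintype F] [CommRing R] [Algebra F R] (p : MvPolynomial σ R)
    (h : p.totalDegree < (Fintype.card F - 1) * Fintype.card σ) :
    ∑ x : σ → F, eval (fun i => algebraMap F R (x i)) p = 0 := by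
  simp only [eval_eq']
  rw [Finset.sum_comm]
  refine Finset.sum_eq_zero fun m hm => ?_
  have hmon := sum_eval_eq_zero (monomial m (1 : F))
    ((totalDegree_monomial_le m 1).trans_lt ((le_totalDegree hm).trans_lt h))
  simp only [eval_monomial, one_mul, Finsupp.prod_fintype _ _ fun i => pow_zero _] at hmon
  rw [← Finset.mul_sum]
  simp only [← map_pow, ← map_prod, ← map_sum, hmon, map_zero, mul_zero]

end MvPolynomial

theorem monicOf_ne_zero (F : Type*) [Field F] (d : ℕ) (c : Fin d → F) : monicOf F d c ≠ 0 :=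
  (Polynomial.monic_X_pow_add (Polynomial.degree_sum_fin_lt c)).ne_zero

/-- The sum over monic polynomials `a` of degree `d` of a product of fewer than `d (q - 1)`
specializations of `a` vanishes. -/
theorem sum_prod_aeval_monicOf_eq_zero {F R : Type*} [Field F] [Fintype F] [CommRing R]
    [Algebra F R] (d : ℕ) (M : Multiset R) (hM : M.card < d * (Fintype.card F - 1)) :
    ∑ c : Fin d → F, (M.map fun x => Polynomial.aeval x (monicOf F d c)).prod = 0 := by
  classical
  let f : R → MvPolynomial (Fin d) R := fun x =>
    MvPolynomial.C (x ^ d) + ∑ i : Fin d, MvPolynomial.X i * MvPolynomial.C (x ^ (i : ℕ))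
  have hf : ∀ x, (f x).totalDegree ≤ 1 := by
    intro x
    refine (MvPolynomial.totalDegree_add _ _).trans (max_le ((MvPolynomial.totalDegree_C _).trans_le zero_le_one) ?_)
    refine MvPolynomial.totalDegree_finsetSum_le fun i _ => ?_
    refine (MvPolynomial.totalDegree_mul _ _).trans ?_
    rw [MvPolynomial.totalDegree_C, add_zero, MvPolynomial.X]
    exact (MvPolynomial.totalDegree_monomial_le _ _).trans (by simp)
  have hdeg : (M.map f).prod.totalDegree ≤ M.card := by
    refine (MvPolynomial.totalDegree_multiset_prod _).trans ?_
    rw [Multiset.map_map]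
    refine (Multiset.sum_le_card_nsmul _ 1 ?_).trans (by simp)
    simpa using fun x _ => hf x
  have hsum := MvPolynomial.sum_eval_algebraMap_eq_zero (F := F) (M.map f).prod
    (hdeg.trans_lt (by rwa [Fintype.card_fin, mul_comm]))
  rw [← hsum]
  refine Finset.sum_congr rfl fun c _ => ?_
  rw [map_multiset_prod, Multiset.map_map]
  simp [f, monicOf]

/-- The `n`-th power of a specialization of `a` is a product of `ℓ_q(n)` specializations of `a`. -/
theorem exists_multiset_prod_aeval_eq_pow {F R : Type*} [Field F] [Fintype F] [CommRing R]
    [Algebra F R] (n : ℕ) (x : R) :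
    ∃ M : Multiset R, M.card = lq (Fintype.card F) n ∧
      ∀ a : Polynomial F, (M.map fun y => Polynomial.aeval y a).prod = Polynomial.aeval x a ^ n := by
  induction n using Nat.strong_induction_on generalizing x with
  | _ n ih =>
  rcases Nat.eq_zero_or_pos n with rfl | hn
  · exact ⟨0, by simp [lq]⟩
  have hq : 1 < Fintype.card F := Fintype.one_lt_card
  obtain ⟨M, hM, hMa⟩ := ih (n / Fintype.card F) (Nat.div_lt_self hn hq) (x ^ Fintype.card F)
  refine ⟨Multiset.replicate (n % Fintype.card F) x + M, ?_, fun a => ?_⟩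
  · simp [lq, Nat.digits_def' hq hn, hM]
  · rw [Multiset.map_add, Multiset.prod_add, hMa, Multiset.map_replicate, Multiset.prod_replicate,
      ← Polynomial.expand_aeval, FiniteField.expand_card, map_pow, ← pow_mul, ← pow_add,
      Nat.mod_add_div]

/-- If `q^l ≥ α` and `2 ≤ ℓ_q(q^l − α) + s ≤ d(q−1)`, then
`∏_{j=1}^{s} (t_j − θ^{q^l})` divides `S_{d,s}(−α)` in `K[t₁,…,t_s]`. -/
theorem prod_dvd_SdsK (F : Type*) [Field F] [Fintype F] (q : ℕ) (hq : Fintype.card F = q)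
    (d s α l : ℕ) (hd : 0 ≤ d) (hs : 1 ≤ s) (hα : 1 ≤ α) (hl : α ≤ q ^ l)
    (h2 : 2 ≤ lq q (q ^ l - α) + s) (hds : lq q (q ^ l - α) + s ≤ d * (q - 1)) :
    (∏ j : Fin s,
        (MvPolynomial.X j -
          MvPolynomial.C (algebraMap (Polynomial F) (RatFunc F) (Polynomial.X ^ q ^ l)))) ∣
      SdsK F d s α := by
  classical
  subst hq
  refine MvPolynomial.prod_X_sub_C_dvd
    (fun _ => algebraMap (Polynomial F) (RatFunc F) (Polynomial.X ^ Fintype.card F ^ l)) _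
    fun j => ?_
  let R := MvPolynomial (Fin s) (RatFunc F)
  let x : R := MvPolynomial.C (algebraMap (Polynomial F) (RatFunc F) Polynomial.X)
  have hx : ∀ a : Polynomial F,
      Polynomial.aeval x a = MvPolynomial.C (algebraMap (Polynomial F) (RatFunc F) a) := by
    intro a
    have : Polynomial.aeval x =
        (IsScalarTower.toAlgHom F (RatFunc F) R).comp
          (IsScalarTower.toAlgHom F (Polynomial F) (RatFunc F)) := by
      ext
      simp [x, R, MvPolynomial.algebraMap_eq]
    rw [this]
    simp [R, MvPolynomial.algebraMap_eq]
  have hxq : ∀ a : Polynomial F,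
      Polynomial.aeval (x ^ Fintype.card F ^ l) a = Polynomial.aeval x a ^ Fintype.card F ^ l := by
    clear hds h2 hl
    intro a
    induction l with
    | zero => simp
    | succ l ih =>
      rw [pow_succ, pow_mul, ← Polynomial.expand_aeval, FiniteField.expand_card, map_pow, ih,
        ← pow_mul]
  obtain ⟨M, hM, hMa⟩ :=
    exists_multiset_prod_aeval_eq_pow (F := F) (Fintype.card F ^ l - α) x
  have hsum := sum_prod_aeval_monicOf_eq_zero (F := F) d
    (M + (Finset.univ.erase j).val.map (MvPolynomial.X : Fin s → R)) (by
      rw [Multiset.card_add, hM, Multiset.card_map, Finset.card_val,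
        Finset.card_erase_of_mem (Finset.mem_univ j), Finset.card_univ, Fintype.card_fin]
      omega)
  rw [← hsum, SdsK, map_sum]
  refine Finset.sum_congr rfl fun c _ => ?_
  have ha : algebraMap (Polynomial F) (RatFunc F) (monicOf F d c) ≠ 0 :=
    (map_ne_zero_iff _ (IsFractionRing.injective _ _)).2 (monicOf_ne_zero F d c)
  have hsub : ∀ i, MvPolynomial.aeval (Function.update MvPolynomial.X j (MvPolynomial.C
        (algebraMap (Polynomial F) (RatFunc F) (Polynomial.X ^ Fintype.card F ^ l))) : Fin s → R)
        (Polynomial.aeval (MvPolynomial.X i : R) (monicOf F d c)) =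
      Polynomial.aeval (Function.update MvPolynomial.X j (x ^ Fintype.card F ^ l) i)
        (monicOf F d c) := by
    intro i
    have := Polynomial.aeval_algHom_apply ((MvPolynomial.aeval (Function.update MvPolynomial.X j
      (MvPolynomial.C (algebraMap (Polynomial F) (RatFunc F) (Polynomial.X ^ Fintype.card F ^ l))) :
        Fin s → R)).restrictScalars F) (MvPolynomial.X i : R) (monicOf F d c)
    simpa [x] using this.symm
  rw [map_mul, map_prod, MvPolynomial.aeval_C, MvPolynomial.algebraMap_eq,
    Finset.prod_congr rfl fun i _ => hsub i, ← Finset.mul_prod_erase _ _ (Finset.mem_univ j),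
    Function.update_self, hxq, hx, ← mul_assoc, ← map_pow, ← map_mul, Multiset.map_add,
    Multiset.prod_add, hMa, hx, ← map_pow, Multiset.map_map]
  congr 1
  · rw [← map_pow, map_pow (algebraMap _ _), pow_sub₀ _ ha hl, inv_pow, mul_comm]
  · refine Finset.prod_congr rfl fun i hi => ?_
    rw [Function.update_of_ne (Finset.ne_of_mem_erase hi), Function.comp_apply]
end

section
/- Let q ≥ 2 be an integer, let α ≥ 1 be an integer, and let m ≥ 0 be an integer with q^m ≥ α. Then for every integer l ≥ m, one has ℓ_q(q^l − α) = (q−1)(l − m) + ℓ_q(q^m − α). -/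
theorem lq_add_base_mul {q x : ℕ} (hq : 2 ≤ q) (hx : x < q) (y : ℕ) :
    lq q (x + q * y) = x + lq q y := by
  unfold lq
  by_cases h : x ≠ 0 ∨ y ≠ 0
  · rw [Nat.digits_add q hq x y hx h, List.sum_cons]
  · obtain ⟨rfl, rfl⟩ : x = 0 ∧ y = 0 := by omega
    simp

theorem lq_add_pow_mul {q : ℕ} (hq : 2 ≤ q) (m : ℕ) {r : ℕ} (hr : r < q ^ m) (y : ℕ) :
    lq q (r + q ^ m * y) = lq q r + lq q y := by
  induction m generalizing r with
  | zero =>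
    obtain rfl : r = 0 := by simpa using hr
    simp [lq]
  | succ m ih =>
    have hmod : r % q < q := Nat.mod_lt _ (by omega)
    have hdiv : r / q < q ^ m := Nat.div_lt_of_lt_mul (by rwa [← pow_succ'])
    have hsplit : r + q ^ (m + 1) * y = r % q + q * (r / q + q ^ m * y) := by
      rw [mul_add, ← add_assoc, Nat.mod_add_div, pow_succ', mul_assoc]
    have hlq : lq q r = r % q + lq q (r / q) := by
      rw [← lq_add_base_mul hq hmod, Nat.mod_add_div]
    rw [hsplit, lq_add_base_mul hq hmod, ih hdiv, hlq, add_assoc]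

theorem lq_of_lt {q x : ℕ} (hq : 2 ≤ q) (hx : x < q) : lq q x = x := by
  simpa [lq] using lq_add_base_mul hq hx 0

/-- For `q ≥ 2`, `α ≥ 1`, `q^m ≥ α` and `l ≥ m`, one has
`ℓ_q(q^l − α) = (q−1)(l − m) + ℓ_q(q^m − α)`. -/
theorem lq_pow_sub (q α m l : ℕ) (hq : 2 ≤ q) (hα : 1 ≤ α) (hm : α ≤ q ^ m) (hl : m ≤ l) :
    lq q (q ^ l - α) = (q - 1) * (l - m) + lq q (q ^ m - α) := by
  induction l, hl using Nat.le_induction with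
  | base => simp
  | succ l hl ih =>
    have hle : α ≤ q ^ l := hm.trans (Nat.pow_le_pow_right (by omega) hl)
    have hsplit : q ^ (l + 1) - α = (q ^ l - α) + q ^ l * (q - 1) := by
      have hpow : q ^ (l + 1) = q ^ l + q ^ l * (q - 1) := by
        rw [pow_succ, ← mul_one_add, Nat.add_sub_cancel' (by omega)]
      omega
    rw [hsplit, lq_add_pow_mul hq l (by omega), lq_of_lt hq (x := q - 1) (by omega), ih,
      Nat.sub_add_comm hl]
    ring
end
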